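/- For all a, d ≥ 1 with ⌈d/a⌉ ≥ 105 and all n ≥ 1, q_d^{(a)}(n) ≥ Q_d^{(a,−,−)}(n). -/

import Mathlib

/-- `rho A n` is the number of partitions of `n` all of whose parts lie in `A`. -/
noncomputable def rho (A : Set ℕ) (n : ℕ) : ℕ :=
  Nat.card {p : n.Partition // ∀ x ∈ p.parts, x ∈ A}

/-- `qpart a d n` is the number of partitions of `n` into parts that are all `≥ a`
and pairwise differ by at least `d` (so, in particular, are distinct when `d ≥ 1`). -/
noncomputable def qpart (a d n : ℕ) : ℕ :=
  Nat.card {p : n.Partition //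
    (∀ x ∈ p.parts, a ≤ x) ∧
    (∀ x ∈ p.parts, p.parts.count x ≤ 1) ∧
    (∀ x ∈ p.parts, ∀ y ∈ p.parts, x ≠ y → d ≤ max x y - min x y)}

/-- Positive integers congruent to `±a` modulo `m`, excluding `m - a`. -/
noncomputable def QminusSet (a m : ℕ) : Set ℕ :=
  {x | x % m = a % m ∨ x % m = (m - a) % m} \ {m - a}

/-- `Qminus a d n` counts partitions of `n` into parts `≡ ±a (mod d+3)`,
excluding the part `d+3-a`. -/
noncomputable def Qminus (a d n : ℕ) : ℕ := rho (QminusSet a (d + 3)) n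

/-- `Qmm a d n` counts partitions of `n` into parts `≡ ±a (mod d+3)`,
excluding both the parts `a` and `d+3-a`. -/
noncomputable def Qmm (a d n : ℕ) : ℕ := rho (QminusSet a (d + 3) \ {a}) n

/-- `Tset s d` is the set of naturals congruent to `1` or to `d + 2^j` for some
`1 ≤ j ≤ s - 1` modulo `2d`. -/
def Tset (s d : ℕ) : Set ℕ :=
  {y | y % (2 * d) = 1 % (2 * d) ∨
    ∃ j, 1 ≤ j ∧ j + 1 ≤ s ∧ y % (2 * d) = (d + 2 ^ j) % (2 * d)}

/-- `T5 d` : naturals congruent to `1, d+2, d+4, d+8` or `d+16` modulo `2d`. -/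
def T5 (d : ℕ) : Set ℕ := Tset 5 d

/-- `Sset d N` : naturals congruent to `±1` modulo `d-N+3`, excluding `d-N+2`. -/
def Sset (d N : ℕ) : Set ℕ :=
  {x | x % (d - N + 3) = 1 % (d - N + 3) ∨ x % (d - N + 3) = (d - N + 2) % (d - N + 3)}
    \ {d - N + 2}

/-- `xN d N i` is the `i`-th smallest element of `Sset d N` (1-indexed). -/
noncomputable def xN (d N i : ℕ) : ℕ := Nat.nth (· ∈ Sset d N) (i - 1)

/-- `yT d i` is the `i`-th smallest element of `T5 d` (1-indexed). -/
noncomputable def yT (d i : ℕ) : ℕ := Nat.nth (· ∈ T5 d) (i - 1)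

/-- The sets of `k` naturals `≥ a`, pairwise differing by at least `d`, with sum `n`. -/
def gapSets (d k a n : ℕ) : Finset (Finset ℕ) :=
  (Finset.range (n + 1)).powerset.filter fun s =>
    s.card = k ∧ ∑ x ∈ s, x = n ∧ (∀ x ∈ s, a ≤ x) ∧ ∀ x ∈ s, ∀ y ∈ s, x < y → x + d ≤ y

theorem mem_gapSets {d k a n : ℕ} {s : Finset ℕ} :
    s ∈ gapSets d k a n ↔ s.card = k ∧ ∑ x ∈ s, x = n ∧ (∀ x ∈ s, a ≤ x) ∧
      ∀ x ∈ s, ∀ y ∈ s, x < y → x + d ≤ y := by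
  simp only [gapSets, Finset.mem_filter, Finset.mem_powerset, and_iff_right_iff_imp]
  rintro ⟨-, rfl, -, -⟩ x hx
  have : x ≤ ∑ x ∈ s, x := Finset.single_le_sum (f := fun x => x) (fun _ _ => Nat.zero_le _) hx
  simpa [Nat.lt_succ_iff] using this

theorem card_insert_gapSets {d : ℕ} (hd : 1 ≤ d) (k a n : ℕ) :
    ((gapSets d k (a + d) n).image (insert a)).card = (gapSets d k (a + d) n).card := by
  refine Finset.card_image_of_injOn ?_
  have not_mem : ∀ s ∈ gapSets d k (a + d) n, a ∉ s := fun s hs has => by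
    have := (mem_gapSets.1 hs).2.2.1 a has
    omega
  intro s hs t ht hst
  have h := congrArg (fun u => Finset.erase u a) hst
  simpa [Finset.erase_insert (not_mem s hs), Finset.erase_insert (not_mem t ht)] using h

theorem insert_image_subset_gapSets (d k a n : ℕ) (hd : 1 ≤ d) :
    (gapSets d k (a + d) n).image (insert a) ⊆ gapSets d (k + 1) a (n + a) := by
  intro u hu
  obtain ⟨s, hs, rfl⟩ := Finset.mem_image.1 hu
  obtain ⟨hc, hsum, hge, hgap⟩ := mem_gapSets.1 hs
  have has : a ∉ s := fun h => by have := hge a h; omega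
  refine mem_gapSets.2 ⟨by rw [Finset.card_insert_of_notMem has, hc],
    by rw [Finset.sum_insert has, hsum, add_comm], ?_, ?_⟩
  · intro x hx
    rcases Finset.mem_insert.1 hx with rfl | hx
    · exact le_rfl
    · have := hge x hx; omega
  · intro x hx y hy hxy
    rcases Finset.mem_insert.1 hx with rfl | hx <;> rcases Finset.mem_insert.1 hy with rfl | hy
    · omega
    · exact hge y hy
    · have := hge x (by assumption); omega
    · exact hgap x (by assumption) y hy hxy

theorem map_succ_subset_gapSets (d k a n : ℕ) :
    (gapSets d k a n).map (Finset.mapEmbedding (addRightEmbedding 1)).toEmbedding ⊆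
      gapSets d k a (n + k) := by
  intro u hu
  obtain ⟨s, hs, rfl⟩ := Finset.mem_map.1 hu
  obtain ⟨hc, hsum, hge, hgap⟩ := mem_gapSets.1 hs
  refine mem_gapSets.2 ⟨by simp [hc], by simp [Finset.sum_add_distrib, hsum, hc], ?_, ?_⟩
  · intro x hx
    obtain ⟨z, hz, rfl⟩ : ∃ z ∈ s, z + 1 = x := by simpa using hx
    have := hge z hz; omega
  · intro x hx y hy hxy
    obtain ⟨z, hz, rfl⟩ : ∃ z ∈ s, z + 1 = x := by simpa using hx
    obtain ⟨w, hw, rfl⟩ : ∃ w ∈ s, w + 1 = y := by simpa using hy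
    have := hgap z hz w hw (by omega); omega

theorem card_gapSets_add_card_gapSets_le {d : ℕ} (hd : 1 ≤ d) {k a n m : ℕ}
    (h : m + (k + 1) = n + a) :
    (gapSets d k (a + d) n).card + (gapSets d (k + 1) a m).card ≤
      (gapSets d (k + 1) a (n + a)).card := by
  rw [← card_insert_gapSets hd,
    ← Finset.card_map (s := gapSets d (k + 1) a m)
      (Finset.mapEmbedding (addRightEmbedding 1)).toEmbedding,
    ← Finset.card_union_of_disjoint]
  · refine Finset.card_le_card (Finset.union_subset (insert_image_subset_gapSets d k a n hd) ?_)
    rw [← h]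
    exact map_succ_subset_gapSets d (k + 1) a m
  · refine Finset.disjoint_left.2 fun u hu hu' => ?_
    obtain ⟨s, -, rfl⟩ := Finset.mem_image.1 hu
    obtain ⟨t, ht, hts⟩ := Finset.mem_map.1 hu'
    have ha : a ∈ insert a s := Finset.mem_insert_self a s
    rw [← hts] at ha
    obtain ⟨z, hz, hza⟩ : ∃ z ∈ t, z + 1 = a := by simpa using ha
    have := (mem_gapSets.1 ht).2.2.1 z hz
    omega

theorem add_pow_succ_le (r t k : ℕ) :
    (r + t) ^ (k + 1) ≤ r ^ (k + 1) + (k + 1) * t * (r + t) ^ k := by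
  induction k with
  | zero => simp
  | succ k ih =>
    have h : r * ((k + 1) * t * (r + t) ^ k) ≤ (k + 1) * t * (r + t) ^ (k + 1) := by
      rw [pow_succ (r + t) k]
      nlinarith [Nat.zero_le ((k + 1) * t * (r + t) ^ k * t)]
    calc (r + t) ^ (k + 1 + 1) = r * (r + t) ^ (k + 1) + t * (r + t) ^ (k + 1) := by ring
      _ ≤ r * (r ^ (k + 1) + (k + 1) * t * (r + t) ^ k) + t * (r + t) ^ (k + 1) := by gcongr
      _ = r ^ (k + 1 + 1) + r * ((k + 1) * t * (r + t) ^ k) + t * (r + t) ^ (k + 1) := by ring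
      _ ≤ r ^ (k + 1 + 1) + (k + 1) * t * (r + t) ^ (k + 1) + t * (r + t) ^ (k + 1) := by gcongr
      _ = r ^ (k + 1 + 1) + (k + 1 + 1) * t * (r + t) ^ (k + 1) := by ring

theorem pow_le_card_gapSets {d : ℕ} (hd : 1 ≤ d) (k R a : ℕ) :
    R ^ k ≤ k.factorial * (k + 1).factorial *
      (gapSets d (k + 1) a ((k + 1) * a + d * (k + 1).choose 2 + R)).card := by
  induction k generalizing R a with
  | zero =>
    have : 0 < (gapSets d 1 a (a + R)).card :=
      Finset.card_pos.2 ⟨{a + R}, mem_gapSets.2 (by simp)⟩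
    simpa using this
  | succ k ihk =>
    have hch : (k + 1 + 1).choose 2 = (k + 1) + (k + 1).choose 2 := by
      rw [Nat.choose_succ_succ' (k + 1) 1, Nat.choose_one_right]
    have hn : (k + 1 + 1) * a + d * (k + 1 + 1).choose 2 + R =
        ((k + 1) * (a + d) + d * (k + 1).choose 2 + R) + a := by
      rw [hch]; ring
    have hfac : (k + 1).factorial * (k + 1 + 1).factorial =
        (k + 1) * (k + 2) * (k.factorial * (k + 1).factorial) := by
      rw [Nat.factorial_succ (k + 1), Nat.factorial_succ k]; ring
    induction R using Nat.strong_induction_on with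
    | _ R ihR =>
    have first := ihk R (a + d)
    rcases lt_or_ge R (k + 2) with hR | hR
    · have hle := Finset.card_le_card
        (insert_image_subset_gapSets d (k + 1) a ((k + 1) * (a + d) + d * (k + 1).choose 2 + R) hd)
      rw [card_insert_gapSets hd, ← hn] at hle
      calc R ^ (k + 1) = R * R ^ k := by ring
        _ ≤ ((k + 1) * (k + 2)) * (k.factorial * (k + 1).factorial * _) := by
            refine Nat.mul_le_mul ?_ (first.trans (Nat.mul_le_mul_left _ hle))
            nlinarith
        _ = _ := by rw [hfac]; ring
    · obtain ⟨r, rfl⟩ := Nat.exists_eq_add_of_le' hR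
      have second := ihR r (by omega) (by rw [hch]; ring)
      have hrec := card_gapSets_add_card_gapSets_le hd (k := k + 1) (a := a)
        (n := (k + 1) * (a + d) + d * (k + 1).choose 2 + (r + (k + 2)))
        (m := (k + 1 + 1) * a + d * (k + 1 + 1).choose 2 + r) (by rw [hch]; ring)
      rw [← hn] at hrec
      calc (r + (k + 2)) ^ (k + 1)
          ≤ r ^ (k + 1) + (k + 1) * (k + 2) * (r + (k + 2)) ^ k := add_pow_succ_le _ _ _
        _ ≤ _ + (k + 1) * (k + 2) * _ := Nat.add_le_add second (Nat.mul_le_mul_left _ first)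
        _ = (k + 1).factorial * (k + 1 + 1).factorial * (_ + _) := by
            rw [hfac]; ring
        _ ≤ _ := Nat.mul_le_mul_left _ hrec

theorem card_gapSets_le_qpart {a d k n : ℕ} (ha : 1 ≤ a) :
    (gapSets d k a n).card ≤ qpart a d n := by
  rw [← Nat.card_eq_finsetCard, qpart]
  refine Nat.card_le_card_of_injective (fun s => ⟨⟨s.1.val, ?_, ?_⟩, ?_, ?_, ?_⟩) ?_
  · intro i hi
    exact ha.trans ((mem_gapSets.1 s.2).2.2.1 i hi)
  · exact (Finset.sum_val s.1).trans (mem_gapSets.1 s.2).2.1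
  · exact (mem_gapSets.1 s.2).2.2.1
  · intro x _
    exact Multiset.nodup_iff_count_le_one.1 s.1.nodup x
  · intro x hx y hy hxy
    have hgap := (mem_gapSets.1 s.2).2.2.2
    rcases lt_or_gt_of_ne hxy with h | h
    · have := hgap x hx y hy h; omega
    · have := hgap y hy x hx h; omega
  · intro s t hst
    have h := congrArg (fun p => p.1.parts) hst
    exact Subtype.ext (Finset.val_injective h)

/-- A generating function bound: if each part `x ∈ T` has weight `w x` and the partitions counted
have total weight at most `L`, their number is at most `v ^ (-L) * ∏ (1 - v ^ w x)⁻¹`. -/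
theorem card_partition_mul_pow_le {n L : ℕ} (P : n.Partition → Prop) (T : Finset ℕ)
    (w : ℕ → ℕ) (hT : ∀ p, P p → ∀ x ∈ p.parts, x ∈ T) (hw : ∀ x ∈ T, 1 ≤ w x)
    (hL : ∀ p, P p → ∑ x ∈ T, w x * p.parts.count x ≤ L)
    {v : ℝ} (hv0 : 0 < v) (hv1 : v < 1) :
    (Nat.card {p : n.Partition // P p} : ℝ) * v ^ L ≤ ∏ x ∈ T, (1 - v ^ w x)⁻¹ := by
  classical
  let e : {p : n.Partition // P p} → ((x : ℕ) → x ∈ T → ℕ) := fun p x _ => p.1.parts.count x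
  have he : Function.Injective e := by
    intro p q hpq
    refine Subtype.ext (Nat.Partition.ext (Multiset.ext.2 fun x => ?_))
    by_cases hx : x ∈ T
    · exact congrFun (congrFun hpq x) hx
    · rw [Multiset.count_eq_zero_of_notMem fun h => hx (hT p.1 p.2 x h),
        Multiset.count_eq_zero_of_notMem fun h => hx (hT q.1 q.2 x h)]
  have hmem : ∀ p, e p ∈ T.pi fun _ => Finset.range (n + 1) := by
    intro p
    refine Finset.mem_pi.2 fun x _ => ?_
    have h1 : p.1.parts.count x ≤ p.1.parts.card := Multiset.count_le_card x _
    have h2 : p.1.parts.card • 1 ≤ p.1.parts.sum :=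
      Multiset.card_nsmul_le_sum fun x hx => p.1.parts_pos hx
    rw [p.1.parts_sum] at h2
    rw [smul_eq_mul, mul_one] at h2
    exact Finset.mem_range.2 (Nat.lt_succ_of_le (h1.trans h2))
  calc (Nat.card {p : n.Partition // P p} : ℝ) * v ^ L
      = ∑ _p : {p : n.Partition // P p}, v ^ L := by
        rw [Finset.sum_const, Finset.card_univ, Nat.card_eq_fintype_card, nsmul_eq_mul]
    _ ≤ ∑ p : {p : n.Partition // P p}, ∏ x ∈ T.attach, (v ^ w x.1) ^ e p x.1 x.2 := by
        refine Finset.sum_le_sum fun p _ => ?_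
        have : ∏ x ∈ T.attach, (v ^ w x.1) ^ e p x.1 x.2 =
            v ^ ∑ x ∈ T, w x * p.1.parts.count x := by
          rw [← Finset.prod_pow_eq_pow_sum, ← Finset.prod_attach T]
          simp only [pow_mul, e]
        rw [this]
        exact pow_le_pow_of_le_one hv0.le hv1.le (hL p.1 p.2)
    _ = ∑ f ∈ Finset.univ.image e, ∏ x ∈ T.attach, (v ^ w x.1) ^ f x.1 x.2 := by
        rw [Finset.sum_image fun _ _ _ _ h => he h]
    _ ≤ ∑ f ∈ T.pi fun _ => Finset.range (n + 1),
          ∏ x ∈ T.attach, (v ^ w x.1) ^ f x.1 x.2 := by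
        refine Finset.sum_le_sum_of_subset_of_nonneg ?_ fun _ _ _ => by positivity
        intro f hf
        obtain ⟨p, -, rfl⟩ := Finset.mem_image.1 hf
        exact hmem p
    _ = ∏ x ∈ T, ∑ i ∈ Finset.range (n + 1), (v ^ w x) ^ i := by
        rw [Finset.prod_sum]
    _ ≤ ∏ x ∈ T, (1 - v ^ w x)⁻¹ := by
        refine Finset.prod_le_prod (fun _ _ => by positivity) fun x hx => ?_
        have h0 : 0 ≤ v ^ w x := by positivity
        have h1 : v ^ w x < 1 := pow_lt_one₀ hv0.le hv1 (by have := hw x hx; omega)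
        rw [← tsum_geometric_of_lt_one h0 h1]
        exact (summable_geometric_of_lt_one h0 h1).sum_le_tsum _ fun _ _ => by positivity

theorem exists_of_mem_QminusSet {a m x : ℕ} (ham : 2 * a < m) (hx : x ∈ QminusSet a m \ {a}) :
    (∃ k, 1 ≤ k ∧ x = k * m + a) ∨ ∃ k, 2 ≤ k ∧ x = k * m - a := by
  obtain ⟨⟨hmod, hne⟩, hne'⟩ := hx
  simp only [Set.mem_singleton_iff, Set.mem_ofPred_eq] at hmod hne hne'
  have hx' := Nat.div_add_mod x m
  rcases hmod with h | h
  · rw [h, Nat.mod_eq_of_lt (by omega)] at hx'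
    have h0 : x / m ≠ 0 := fun h0 => hne' (by rw [h0] at hx'; omega)
    exact Or.inl ⟨x / m, Nat.one_le_iff_ne_zero.2 h0, by rw [mul_comm, hx']⟩
  · rcases Nat.eq_zero_or_pos a with rfl | ha
    · rw [h, Nat.sub_zero, Nat.mod_self] at hx'
      have h0 : x / m ≠ 0 := fun h0 => hne' (by rw [h0] at hx'; omega)
      exact Or.inl ⟨x / m, Nat.one_le_iff_ne_zero.2 h0, by rw [mul_comm, hx']⟩
    · rw [h, Nat.mod_eq_of_lt (by omega)] at hx'
      have h0 : x / m ≠ 0 := fun h0 => hne (by rw [h0] at hx'; omega)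
      have : (x / m + 1) * m = m * (x / m) + m := by ring
      exact Or.inr ⟨x / m + 1, Nat.succ_le_succ (Nat.one_le_iff_ne_zero.2 h0), by omega⟩

theorem add_le_of_mem_QminusSet {a m x : ℕ} (ham : 2 * a < m) (hx : x ∈ QminusSet a m \ {a}) :
    m + a ≤ x := by
  rcases exists_of_mem_QminusSet ham hx with ⟨k, hk, rfl⟩ | ⟨k, hk, rfl⟩
  · nlinarith
  · have := Nat.mul_le_mul_right m hk
    omega

/-- The generating function bound for `Qmm`, where a part `k(d+3) ± a` has weight `k`. -/
theorem Qmm_mul_pow_le {a d n L : ℕ} (ha : 1 ≤ a) (hda : 2 * a < d + 3)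
    (hL : 2 * n < (L + 1) * (2 * (d + 3) - a)) {v : ℝ} (hv0 : 0 < v) (hv1 : v < 1) :
    (Qmm a d n : ℝ) * v ^ L ≤
      (∏ k ∈ Finset.Icc 1 L, (1 - v ^ k)⁻¹) * ∏ k ∈ Finset.Icc 2 L, (1 - v ^ k)⁻¹ := by
  classical
  obtain ⟨m, hm⟩ : ∃ m, m = d + 3 := ⟨_, rfl⟩
  rw [← hm] at hda hL
  have hm0 : 0 < m := by omega
  have wplus : ∀ k, (k * m + a + a) / m = k := fun k => by
    rw [add_assoc, mul_comm, Nat.mul_add_div hm0, Nat.div_eq_of_lt (by omega), add_zero]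
  have wminus : ∀ k, 1 ≤ k → (k * m - a + a) / m = k := fun k hk => by
    rw [Nat.sub_add_cancel (by nlinarith), Nat.mul_div_cancel _ hm0]
  set A := (Finset.Icc 1 L).image fun k => k * m + a with hA
  set B := (Finset.Icc 2 L).image fun k => k * m - a with hB
  have hrange : ∀ x ∈ A ∪ B, 1 ≤ (x + a) / m ∧ (x + a) / m * (2 * m - a) ≤ 2 * x := by
    intro x hx
    rcases Finset.mem_union.1 hx with hx | hx <;> obtain ⟨k, hk, rfl⟩ := Finset.mem_image.1 hx <;>
      have hk := Finset.mem_Icc.1 hk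
    · rw [wplus]
      refine ⟨hk.1, ?_⟩
      calc k * (2 * m - a) ≤ k * (2 * m) := Nat.mul_le_mul_left _ (Nat.sub_le _ _)
        _ ≤ _ := by linarith
    · rw [wminus k (by omega)]
      refine ⟨by omega, ?_⟩
      rw [Nat.mul_sub, Nat.mul_sub]
      have h2 : 2 * a ≤ k * a := Nat.mul_le_mul_right _ hk.1
      have : k * (2 * m) = 2 * (k * m) := by ring
      omega
  have hparts : ∀ p : n.Partition, (∀ x ∈ p.parts, x ∈ QminusSet a (d + 3) \ {a}) →
      ∀ x ∈ p.parts, x ∈ A ∪ B := by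
    intro p hp x hx
    have hxn : x ≤ n := p.le_of_mem_parts hx
    have bound : ∀ k, k * (2 * m - a) ≤ 2 * x → k ≤ L := fun k hk => by
      by_contra hcon
      have : (L + 1) * (2 * m - a) ≤ k * (2 * m - a) := Nat.mul_le_mul_right _ (by omega)
      omega
    rcases exists_of_mem_QminusSet hda (hm ▸ hp x hx) with ⟨k, hk, rfl⟩ | ⟨k, hk, rfl⟩
    · refine Finset.mem_union_left _
        (Finset.mem_image.2 ⟨k, Finset.mem_Icc.2 ⟨hk, bound k ?_⟩, rfl⟩)
      calc k * (2 * m - a) ≤ k * (2 * m) := Nat.mul_le_mul_left _ (Nat.sub_le _ _)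
        _ ≤ _ := by linarith
    · refine Finset.mem_union_right _
        (Finset.mem_image.2 ⟨k, Finset.mem_Icc.2 ⟨hk, bound k ?_⟩, rfl⟩)
      rw [Nat.mul_sub, Nat.mul_sub]
      have h2 : 2 * a ≤ k * a := Nat.mul_le_mul_right _ hk
      have : k * (2 * m) = 2 * (k * m) := by ring
      omega
  have hmain := card_partition_mul_pow_le (n := n) (L := L)
    (fun p => ∀ x ∈ p.parts, x ∈ QminusSet a (d + 3) \ {a}) (A ∪ B) (fun x => (x + a) / m)
    hparts (fun x hx => (hrange x hx).1) ?_ hv0 hv1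
  · refine hmain.trans ?_
    have hdisj : Disjoint A B := by
      refine Finset.disjoint_left.2 fun x hx hx' => ?_
      obtain ⟨k, hk, rfl⟩ := Finset.mem_image.1 hx
      obtain ⟨j, hj, hjk⟩ := Finset.mem_image.1 hx'
      have hj := Finset.mem_Icc.1 hj
      have h1 := wminus j (by omega)
      rw [hjk, wplus] at h1
      subst h1
      omega
    rw [Finset.prod_union hdisj, hA, hB, Finset.prod_image, Finset.prod_image]
    · refine le_of_eq (congrArg₂ _ (Finset.prod_congr rfl fun k _ => ?_)
        (Finset.prod_congr rfl fun k hk => ?_))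
      · rw [wplus]
      · rw [wminus k (by have := Finset.mem_Icc.1 hk; omega)]
    · intro j hj k hk hjk
      have hj := (Finset.mem_Icc.1 hj).1
      have hk := (Finset.mem_Icc.1 hk).1
      rw [← wminus j (by omega), ← wminus k (by omega)]
      exact congrArg (fun t => (t + a) / m) hjk
    · intro j _ k _ hjk
      rw [← wplus j, ← wplus k]
      exact congrArg (fun t => (t + a) / m) hjk
  · intro p hp
    have hsum : ∑ x ∈ A ∪ B, x * p.parts.count x = n := by
      refine Eq.trans ?_ p.parts_sum
      rw [Finset.sum_multiset_count_of_subset p.parts (A ∪ B)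
        fun x hx => hparts p hp x (Multiset.mem_toFinset.1 hx)]
      exact Finset.sum_congr rfl fun x _ => by rw [smul_eq_mul, mul_comm]
    have hle : (∑ x ∈ A ∪ B, (x + a) / m * p.parts.count x) * (2 * m - a) ≤ 2 * n := by
      refine le_of_le_of_eq ?_ (congrArg (2 * ·) hsum)
      rw [Finset.sum_mul, Finset.mul_sum]
      refine Finset.sum_le_sum fun x hx => ?_
      calc (x + a) / m * p.parts.count x * (2 * m - a)
          = (x + a) / m * (2 * m - a) * p.parts.count x := by ring
        _ ≤ 2 * x * p.parts.count x := Nat.mul_le_mul_right _ (hrange x hx).2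
        _ = _ := by ring
    have := lt_of_mul_lt_mul_right (hle.trans_lt hL) (Nat.zero_le _)
    omega

theorem sum_pow_Icc_le {u : ℝ} (hu0 : 0 ≤ u) (hu1 : u < 1) (L : ℕ) :
    ∑ k ∈ Finset.Icc 1 L, u ^ k ≤ u / (1 - u) := by
  have h : ∑ k ∈ Finset.Icc 1 L, u ^ k = u * ∑ k ∈ Finset.range L, u ^ k := by
    rw [Finset.mul_sum, Finset.range_eq_Ico]
    simp only [← pow_succ']
    exact (Finset.sum_Ico_add' (fun k => u ^ k) 0 L 1).symm
  rw [h, div_eq_mul_inv, ← tsum_geometric_of_lt_one hu0 hu1]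
  exact mul_le_mul_of_nonneg_left
    ((summable_geometric_of_lt_one hu0 hu1).sum_le_tsum _ fun _ _ => by positivity) hu0

theorem pow_succ_div_one_sub_le {v : ℝ} (hv0 : 0 < v) (hv1 : v < 1) (r : ℕ) :
    v ^ (r + 1) / (1 - v ^ (r + 1)) ≤ v / (1 - v) / (r + 1) := by
  have hv : 0 < 1 - v := by linarith
  have hpow : v ^ (r + 1) < 1 := pow_lt_one₀ hv0.le hv1 (by omega)
  have hgeom : ((r : ℝ) + 1) * v ^ r ≤ ∑ i ∈ Finset.range (r + 1), v ^ i := by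
    have := Finset.card_nsmul_le_sum (Finset.range (r + 1)) (fun i => v ^ i) (v ^ r)
      fun i hi => pow_le_pow_of_le_one hv0.le hv1.le (by have := Finset.mem_range.1 hi; omega)
    simpa using this
  have hsum : (∑ i ∈ Finset.range (r + 1), v ^ i) * (1 - v) = 1 - v ^ (r + 1) :=
    geom_sum_mul_neg v (r + 1)
  rw [div_div, div_le_div_iff₀ (by linarith) (by positivity), ← hsum]
  calc v ^ (r + 1) * ((1 - v) * (r + 1)) = v * (((r : ℝ) + 1) * v ^ r * (1 - v)) := by ring
    _ ≤ _ := by gcongr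

theorem prod_inv_one_sub_pow_le_exp {v : ℝ} (hv0 : 0 < v) (hv1 : v < 1) (L : ℕ) :
    ∏ k ∈ Finset.Icc 1 L, (1 - v ^ k)⁻¹ ≤ Real.exp (5 / 3 * (v / (1 - v))) := by
  have hpow : ∀ k ∈ Finset.Icc 1 L, v ^ k < 1 := fun k hk =>
    pow_lt_one₀ hv0.le hv1 (by have := Finset.mem_Icc.1 hk; omega)
  have hv : 0 < 1 - v := by linarith
  have hexp : ∏ k ∈ Finset.Icc 1 L, (1 - v ^ k)⁻¹ =
      Real.exp (∑ k ∈ Finset.Icc 1 L, -Real.log (1 - v ^ k)) := by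
    rw [Real.exp_sum]
    refine Finset.prod_congr rfl fun k hk => ?_
    rw [Real.exp_neg, Real.exp_log (by linarith [hpow k hk])]
  rw [hexp, Real.exp_le_exp]
  have hlog : HasSum (fun r : ℕ => ∑ k ∈ Finset.Icc 1 L, (v ^ k) ^ (r + 1) / ((r : ℝ) + 1))
      (∑ k ∈ Finset.Icc 1 L, -Real.log (1 - v ^ k)) :=
    hasSum_sum fun k hk => Real.hasSum_pow_div_log_of_abs_lt_one
      (by rw [abs_of_nonneg (by positivity)]; exact hpow k hk)
  have hzeta : HasSum (fun r : ℕ => v / (1 - v) * (1 / ((r + 1 : ℕ) : ℝ) ^ 2))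
      (v / (1 - v) * (Real.pi ^ 2 / 6)) := by
    refine HasSum.mul_left _ ?_
    simpa using (hasSum_nat_add_iff' (f := fun r : ℕ => 1 / (r : ℝ) ^ 2) 1).2 hasSum_zeta_two
  have hle : ∑ k ∈ Finset.Icc 1 L, -Real.log (1 - v ^ k) ≤ v / (1 - v) * (Real.pi ^ 2 / 6) := by
    refine hasSum_le (fun r => ?_) hlog hzeta
    have hr : (0 : ℝ) < r + 1 := by positivity
    have hu1 : v ^ (r + 1) < 1 := pow_lt_one₀ hv0.le hv1 (by omega)
    have h1 := (sum_pow_Icc_le (by positivity) hu1 L).trans (pow_succ_div_one_sub_le hv0 hv1 r)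
    have h2 : ∑ k ∈ Finset.Icc 1 L, (v ^ k) ^ (r + 1) = ∑ k ∈ Finset.Icc 1 L, (v ^ (r + 1)) ^ k :=
      Finset.sum_congr rfl fun k _ => by rw [← pow_mul, ← pow_mul, mul_comm]
    rw [← Finset.sum_div, h2, div_le_iff₀ hr]
    refine h1.trans (le_of_eq ?_)
    push_cast
    field_simp
  have hpi : Real.pi ^ 2 / 6 ≤ 5 / 3 := by
    nlinarith [Real.pi_lt_d2, Real.pi_pos]
  have hy : 0 ≤ v / (1 - v) := by positivity
  nlinarith

theorem Qmm_le_exp {a d n L y : ℕ} (ha : 1 ≤ a) (hda : 2 * a < d + 3) (hL1 : 1 ≤ L)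
    (hL : 2 * n < (L + 1) * (2 * (d + 3) - a)) (hy : 1 ≤ y) :
    (Qmm a d n : ℝ) ≤ (1 + 1 / (y : ℝ)) ^ L * Real.exp (10 / 3 * y) / (y + 1) := by
  have hy0 : (0 : ℝ) < y := by exact_mod_cast hy
  obtain ⟨v, hv⟩ : ∃ v : ℝ, v = y / (y + 1) := ⟨_, rfl⟩
  have hv0 : 0 < v := by rw [hv]; positivity
  have hv1 : v < 1 := by rw [hv, div_lt_one (by positivity)]; linarith
  have h1v : 1 - v = 1 / (y + 1) := by rw [hv]; field_simp; ring
  have hodds : v / (1 - v) = y := by rw [h1v, hv]; field_simp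
  have hvinv : (1 + 1 / (y : ℝ)) * v = 1 := by rw [hv]; field_simp
  have hmain := Qmm_mul_pow_le ha hda hL hv0 hv1
  have hexp := prod_inv_one_sub_pow_le_exp hv0 hv1 L
  rw [hodds] at hexp
  have hsplit : ∏ k ∈ Finset.Icc 1 L, (1 - v ^ k)⁻¹ =
      (1 - v)⁻¹ * ∏ k ∈ Finset.Icc 2 L, (1 - v ^ k)⁻¹ := by
    rw [← Finset.insert_Icc_add_one_left_eq_Icc hL1, Finset.prod_insert (by simp)]
    simp
  set P := ∏ k ∈ Finset.Icc 1 L, (1 - v ^ k)⁻¹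
  have hP0 : 0 ≤ P := Finset.prod_nonneg fun k _ =>
    inv_nonneg.2 (sub_nonneg.2 (pow_le_one₀ hv0.le hv1.le))
  have h2 : ∏ k ∈ Finset.Icc 2 L, (1 - v ^ k)⁻¹ = (1 - v) * P := by
    rw [hsplit, ← mul_assoc, mul_inv_cancel₀ (by linarith), one_mul]
  rw [h2, h1v] at hmain
  have hsq : P * P ≤ Real.exp (10 / 3 * y) := by
    calc P * P ≤ Real.exp (5 / 3 * y) * Real.exp (5 / 3 * y) := by gcongr
      _ = _ := by rw [← Real.exp_add]; ring_nf
  calc (Qmm a d n : ℝ) = (1 + 1 / (y : ℝ)) ^ L * (Qmm a d n * v ^ L) := by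
        rw [mul_left_comm, ← mul_pow, hvinv, one_pow, mul_one]
    _ ≤ (1 + 1 / (y : ℝ)) ^ L * (P * (1 / (y + 1) * P)) := by gcongr
    _ = (1 + 1 / (y : ℝ)) ^ L * (P * P) / (y + 1) := by ring
    _ ≤ _ := by gcongr

theorem Qmm_le_one {a d n : ℕ} (hda : 2 * a < d + 3) (hn : 1 ≤ n)
    (hsmall : n < 2 * (d + 3) - a) : Qmm a d n ≤ 1 := by
  have hpart : ∀ p : n.Partition, (∀ x ∈ p.parts, x ∈ QminusSet a (d + 3) \ {a}) →
      p.parts = {n} := by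
    intro p hp
    have hge : ∀ x ∈ p.parts, d + 3 + a ≤ x := fun x hx =>
      add_le_of_mem_QminusSet hda (hp x hx)
    have hsum := p.parts_sum
    have hcard := Multiset.card_nsmul_le_sum (s := p.parts) hge
    rw [hsum, smul_eq_mul] at hcard
    have hlt : p.parts.card < 2 := by
      by_contra hcon
      have := Nat.mul_le_mul_right (d + 3 + a) (not_lt.1 hcon)
      omega
    have hne : p.parts.card ≠ 0 := fun h => by
      rw [Multiset.card_eq_zero.1 h, Multiset.sum_zero] at hsum
      omega
    obtain ⟨x, hx⟩ := Multiset.card_eq_one.1 (show p.parts.card = 1 by omega)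
    rw [hx, Multiset.sum_singleton] at hsum
    rw [hx, hsum]
  have : Subsingleton {p : n.Partition // ∀ x ∈ p.parts, x ∈ QminusSet a (d + 3) \ {a}} :=
    ⟨fun p q => Subtype.ext (Nat.Partition.ext ((hpart p.1 p.2).trans (hpart q.1 q.2).symm))⟩
  exact Finite.card_le_one_iff_subsingleton.2 this

theorem Qmm_eq_zero {a d n : ℕ} (hda : 2 * a < d + 3) (hn : 1 ≤ n) (hsmall : n < d + 3 + a) :
    Qmm a d n = 0 := by
  have : IsEmpty {p : n.Partition // ∀ x ∈ p.parts, x ∈ QminusSet a (d + 3) \ {a}} := by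
    refine ⟨fun p => ?_⟩
    have hne : p.1.parts ≠ 0 := fun h => by
      have hsum := p.1.parts_sum
      rw [h, Multiset.sum_zero] at hsum
      omega
    obtain ⟨x, hx⟩ := Multiset.exists_mem_of_ne_zero hne
    have h1 := add_le_of_mem_QminusSet hda (p.2 x hx)
    have h2 := p.1.le_of_mem_parts hx
    omega
  exact Nat.card_of_isEmpty

theorem one_le_qpart {a d n : ℕ} (ha : 1 ≤ a) (hd : 1 ≤ d) (han : a ≤ n) : 1 ≤ qpart a d n := by
  have h := pow_le_card_gapSets hd 0 (n - a) a
  have hn : (0 + 1) * a + d * (0 + 1).choose 2 + (n - a) = n := by simp; omega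
  rw [hn] at h
  simpa using h.trans (Nat.mul_le_mul_left _ (card_gapSets_le_qpart ha))

theorem pow_le_qpart {a d n L k X : ℕ} (ha : 1 ≤ a) (hda : 104 * a + 1 ≤ d)
    (hn : L * (2 * (d + 3) - a) ≤ 2 * n) (hL : k * (k + 1) ≤ 2 * L)
    (hL' : 2 * (k + 1) + 104 * (k * (k + 1)) ≤ 207 * L)
    (hX : 2 * X + 2 * (k + 1) + 105 * (k * (k + 1)) ≤ 215 * L) :
    X ^ k ≤ k.factorial * (k + 1).factorial * qpart a d n := by
  have hch : 2 * (k + 1).choose 2 = k * (k + 1) := by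
    rw [Nat.choose_two_right, Nat.add_sub_cancel, mul_comm (k + 1) k,
      Nat.mul_div_cancel' (Nat.even_mul_succ_self k).two_dvd]
  have hle : (k + 1) * a + d * (k + 1).choose 2 + X ≤ n := by
    obtain ⟨e, rfl⟩ := Nat.exists_eq_add_of_le hda
    obtain ⟨b, rfl⟩ := Nat.exists_eq_add_of_le ha
    have hsub : 2 * (104 * (1 + b) + 1 + e + 3) - (1 + b) = 215 + 207 * b + 2 * e := by omega
    rw [hsub] at hn
    have h1 := Nat.mul_le_mul_left b hL'
    have h2 := Nat.mul_le_mul_left e hL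
    have h3 : (104 * (1 + b) + 1 + e) * (2 * (k + 1).choose 2) =
      (104 * (1 + b) + 1 + e) * (k * (k + 1)) := by rw [hch]
    nlinarith
  have h := pow_le_card_gapSets (by omega : 1 ≤ d) k
    (n - ((k + 1) * a + d * (k + 1).choose 2)) a
  rw [Nat.add_sub_cancel' (by omega)] at h
  exact (Nat.pow_le_pow_left (by omega) k).trans
    (h.trans (Nat.mul_le_mul_left _ (card_gapSets_le_qpart ha)))

theorem le_of_le_of_pow_le {p q : ℕ} (k X : ℕ) (b : ℝ) (hb : (p : ℝ) ≤ b)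
    (hq : X ^ k ≤ k.factorial * (k + 1).factorial * q)
    (hbX : b * (k.factorial * (k + 1).factorial : ℕ) ≤ (X : ℝ) ^ k) : p ≤ q := by
  have hpos : (0 : ℝ) < (k.factorial * (k + 1).factorial : ℕ) := by positivity
  have hq' : (X : ℝ) ^ k ≤ (k.factorial * (k + 1).factorial : ℕ) * (q : ℝ) := by
    exact_mod_cast hq
  have : (p : ℝ) * (k.factorial * (k + 1).factorial : ℕ) ≤
      q * (k.factorial * (k + 1).factorial : ℕ) :=
    calc _ ≤ _ := mul_le_mul_of_nonneg_right hb hpos.le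
      _ ≤ _ := hbX
      _ ≤ _ := hq'
      _ = _ := mul_comm _ _
  exact_mod_cast le_of_mul_le_mul_right this hpos

theorem exp_mul_factorial_le (k : ℕ) (hk : 4 ≤ k) :
    Real.exp ((13 * k + 12) / 3) / 4 * (k.factorial * (k + 1).factorial : ℕ) ≤
      (51 * ((k + 3) * k) : ℝ) ^ k := by
  have he := Real.exp_one_lt_d9
  induction k, hk using Nat.le_induction with
  | base =>
    have h22 : Real.exp ((13 * (4 : ℕ) + 12) / 3) ≤ 2.7182818286 ^ 22 := by
      calc Real.exp ((13 * (4 : ℕ) + 12) / 3) ≤ Real.exp (22 : ℕ) := by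
            rw [Real.exp_le_exp]; norm_num
        _ = Real.exp 1 ^ 22 := by rw [← Real.exp_nat_mul]; norm_num
        _ ≤ _ := by gcongr
    norm_num [Nat.factorial] at h22 ⊢
    linarith
  | succ k hk ih =>
    have hk0 : (0 : ℝ) < k := by positivity
    have h13 : Real.exp (13 / 3) ≤ 102 := by
      refine le_of_pow_le_pow_left₀ (n := 3) (by norm_num) (by norm_num) ?_
      calc Real.exp (13 / 3) ^ 3 = Real.exp 1 ^ 13 := by
            rw [← Real.exp_nat_mul, ← Real.exp_nat_mul]; norm_num
        _ ≤ 2.7182818286 ^ 13 := by gcongr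
        _ ≤ _ := by norm_num
    have hbern : (2 : ℝ) ≤ (1 + 1 / k) ^ k := by
      have hinv : 0 ≤ 1 / (k : ℝ) := by positivity
      have := one_add_mul_le_pow (a := 1 / (k : ℝ)) (by linarith) k
      rw [mul_one_div_cancel hk0.ne'] at this
      linarith
    have hratio : 2 * (51 * ((k + 3) * k) : ℝ) ^ k ≤ (51 * ((k + 4) * (k + 1)) : ℝ) ^ k := by
      calc 2 * (51 * ((k + 3) * k) : ℝ) ^ k ≤ (1 + 1 / k) ^ k * (51 * ((k + 3) * k) : ℝ) ^ k := by
            gcongr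
        _ = (51 * ((k + 3) * (k + 1)) : ℝ) ^ k := by
            rw [← mul_pow]; congr 1; field_simp
        _ ≤ _ := by gcongr; norm_num
    have hfac : (((k + 1).factorial * (k + 1 + 1).factorial : ℕ) : ℝ) =
        (k + 1) * (k + 2) * (k.factorial * (k + 1).factorial : ℕ) := by
      rw [Nat.factorial_succ (k + 1), Nat.factorial_succ k]; push_cast; ring
    have hexp : Real.exp ((13 * ((k + 1 : ℕ) : ℝ) + 12) / 3) =
        Real.exp (13 / 3) * Real.exp ((13 * k + 12) / 3) := by
      rw [← Real.exp_add]; congr 1; push_cast; ring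
    rw [hfac, hexp]
    calc Real.exp (13 / 3) * Real.exp ((13 * k + 12) / 3) / 4 *
          ((k + 1) * (k + 2) * (k.factorial * (k + 1).factorial : ℕ))
        = Real.exp (13 / 3) * ((k + 1) * (k + 2)) *
          (Real.exp ((13 * k + 12) / 3) / 4 * (k.factorial * (k + 1).factorial : ℕ)) := by ring
      _ ≤ 102 * ((k + 1) * (k + 4)) * (51 * ((k + 3) * k) : ℝ) ^ k := by
          gcongr; norm_num
      _ = 51 * ((k + 4) * (k + 1)) * (2 * (51 * ((k + 3) * k) : ℝ) ^ k) := by ring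
      _ ≤ 51 * ((k + 4) * (k + 1)) * (51 * ((k + 4) * (k + 1)) : ℝ) ^ k := by gcongr
      _ = _ := by push_cast; ring

theorem Qmm_le_qpart_of_large {a d n L : ℕ} (ha : 1 ≤ a) (hda : 104 * a + 1 ≤ d) (hL24 : 24 ≤ L)
    (hlow : L * (2 * (d + 3) - a) ≤ 2 * n) (hup : 2 * n < (L + 1) * (2 * (d + 3) - a)) :
    Qmm a d n ≤ qpart a d n := by
  obtain ⟨k, hk⟩ : ∃ k, Nat.sqrt (L + 1) = k + 1 :=
    ⟨Nat.sqrt (L + 1) - 1, by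
      have : 5 ≤ Nat.sqrt (L + 1) := Nat.le_sqrt.2 (by omega)
      omega⟩
  have hk4 : 4 ≤ k := by
    have : 5 ≤ Nat.sqrt (L + 1) := Nat.le_sqrt.2 (by omega)
    omega
  have h1 : (k + 1) * (k + 1) ≤ L + 1 := hk ▸ Nat.sqrt_le (L + 1)
  have h2 : L + 1 < (k + 2) * (k + 2) := by
    have := Nat.lt_succ_sqrt (L + 1)
    rwa [hk] at this
  have hq := pow_le_qpart (k := k) (X := 51 * ((k + 3) * k)) ha hda hlow
    (by nlinarith) (by nlinarith) (by nlinarith)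
  obtain ⟨y, rfl⟩ : ∃ y, k = y + 1 := ⟨k - 1, by omega⟩
  have hQ := Qmm_le_exp (y := y) ha (by omega) (by omega) hup (by omega)
  have hy3 : (3 : ℝ) ≤ y := by exact_mod_cast (by omega : 3 ≤ y)
  have hy0 : (0 : ℝ) < y := by linarith
  have hLy : (L : ℝ) ≤ y ^ 2 + 6 * y + 7 := by
    have : L ≤ y ^ 2 + 6 * y + 7 := by nlinarith
    exact_mod_cast this
  have hpow : (1 + 1 / (y : ℝ)) ^ L ≤ Real.exp (y + 25 / 3) := by
    calc (1 + 1 / (y : ℝ)) ^ L ≤ Real.exp (1 / y) ^ L := by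
          gcongr
          linarith [Real.add_one_le_exp (1 / (y : ℝ))]
      _ = Real.exp (L / y) := by rw [← Real.exp_nat_mul]; ring_nf
      _ ≤ _ := by
          rw [Real.exp_le_exp, div_le_iff₀ hy0]
          nlinarith
  have hexp : (Qmm a d n : ℝ) ≤ Real.exp ((13 * (y + 1 : ℕ) + 12) / 3) / 4 := by
    refine hQ.trans ?_
    calc (1 + 1 / (y : ℝ)) ^ L * Real.exp (10 / 3 * y) / (y + 1)
        ≤ Real.exp (y + 25 / 3) * Real.exp (10 / 3 * y) / 4 := by gcongr; linarith
      _ = _ := by rw [← Real.exp_add]; push_cast; ring_nf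
  have hfac := exp_mul_factorial_le (y + 1) hk4
  exact le_of_le_of_pow_le (y + 1) _ _ hexp hq (by exact_mod_cast hfac)

theorem Qmm_le_mul_three_halves_pow {a d n L : ℕ} (ha : 1 ≤ a) (hda : 2 * a < d + 3) (hL1 : 1 ≤ L)
    (hL : 2 * n < (L + 1) * (2 * (d + 3) - a)) :
    (Qmm a d n : ℝ) ≤ (3 / 2) ^ L * 800 / 3 := by
  have he := Real.exp_one_lt_d9
  have h20 : Real.exp (10 / 3 * (2 : ℕ)) ≤ 800 := by
    refine le_of_pow_le_pow_left₀ (n := 3) (by norm_num) (by norm_num) ?_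
    calc Real.exp (10 / 3 * (2 : ℕ)) ^ 3 = Real.exp 1 ^ 20 := by
          rw [← Real.exp_nat_mul, ← Real.exp_nat_mul]; norm_num
      _ ≤ 2.7182818286 ^ 20 := by gcongr
      _ ≤ _ := by norm_num
  have h := Qmm_le_exp (y := 2) ha hda hL1 hL (by norm_num)
  calc (Qmm a d n : ℝ) ≤ _ := h
    _ ≤ (1 + 1 / ((2 : ℕ) : ℝ)) ^ L * 800 / ((2 : ℕ) + 1) := by gcongr
    _ = _ := by norm_num

theorem stmt17 (a d n : ℕ) (ha : 1 ≤ a) (hd : 1 ≤ d)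
    (hda : 105 ≤ (d + a - 1) / a) (hn : 1 ≤ n) :
    Qmm a d n ≤ qpart a d n := by
  have hda' : 104 * a + 1 ≤ d := by
    have := (Nat.le_div_iff_mul_le (by omega : 0 < a)).1 hda
    omega
  have h2a : 2 * a < d + 3 := by omega
  obtain ⟨L, hLdef⟩ : ∃ L, L = 2 * n / (2 * (d + 3) - a) := ⟨_, rfl⟩
  have hlow : L * (2 * (d + 3) - a) ≤ 2 * n := hLdef ▸ Nat.div_mul_le_self _ _
  have hup : 2 * n < (L + 1) * (2 * (d + 3) - a) := by
    rw [hLdef, mul_comm (_ + 1)]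
    exact Nat.lt_mul_div_succ _ (by omega)
  rcases lt_or_ge n a with hna | hna
  · rw [Qmm_eq_zero h2a hn (by omega)]
    exact Nat.zero_le _
  rcases lt_or_ge L 2 with hL2 | hL2
  · refine (Qmm_le_one h2a hn ?_).trans (one_le_qpart ha hd hna)
    have := Nat.mul_le_mul_right (2 * (d + 3) - a) (show L + 1 ≤ 2 by omega)
    omega
  rcases lt_or_ge L 5 with hL5 | hL5
  · have hQ := Qmm_mul_pow_le ha h2a hup (v := 1 / 2) (by norm_num) (by norm_num)
    have hq := pow_le_qpart (k := 1) (X := (215 * L - 214) / 2) ha hda' hlow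
      (by omega) (by omega) (by omega)
    refine le_of_le_of_pow_le 1 _ ((((215 * L - 214) / 2 : ℕ) : ℝ) / 2) ?_ hq
      (by norm_num [Nat.factorial])
    clear hq hLdef hlow hup
    interval_cases L <;> norm_num [Finset.prod_Icc_succ_top, -Nat.cast_le_ofNat] at hQ ⊢ <;>
      linarith
  have hQ := Qmm_le_mul_three_halves_pow ha h2a (by omega) hup
  rcases lt_or_ge L 15 with hL15 | hL15
  · have hq := pow_le_qpart (k := 2) (X := (215 * L - 636) / 2) ha hda' hlow
      (by omega) (by omega) (by omega)
    refine le_of_le_of_pow_le 2 _ _ hQ hq ?_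
    clear hq hLdef hlow hup hQ
    interval_cases L <;> norm_num [Nat.factorial]
  rcases lt_or_ge L 24 with hL24 | hL24
  · have hq := pow_le_qpart (k := 3) (X := 978) ha hda' hlow
      (by omega) (by omega) (by omega)
    refine le_of_le_of_pow_le 3 _ _ hQ hq ?_
    calc (3 / 2 : ℝ) ^ L * 800 / 3 * (Nat.factorial 3 * Nat.factorial (3 + 1) : ℕ)
        ≤ (3 / 2 : ℝ) ^ 23 * 800 / 3 * (Nat.factorial 3 * Nat.factorial (3 + 1) : ℕ) := by
          gcongr
          · norm_num
          · omega
      _ ≤ _ := by norm_num [Nat.factorial]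
  exact Qmm_le_qpart_of_large ha hda' hL24 hlow hup
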